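/- Let s ≥ 1, let α ∈ ℕ with α ≥ 2, and let f : [0,1]^s → ℝ be a function whose mixed partial derivatives up to order α in each variable are continuous on [0,1]^s. Let 1 ≤ p ≤ ∞, let ∅ ≠ v ⊆ S = {1,…,s}, and let k_v = (k_i)_{i∈v} ∈ ℕ^{|v|}, where k_i has binary expansion k_i = ∑_{j=1}^{N_i} 2^{a_{i,j}} with a_{i,1} > ⋯ > a_{i,N_i} ≥ 0. Then the Walsh coefficient of f at (k_v;0) satisfies |f̂((k_v;0))| ≤ 2^{|v|/p} · 2^{−μ'_α(k_v)} · ‖f^{(min(α,N_{k_v}))}‖_p, where min(α, N_{k_v}) denotes the multi-index (min(α, N_i))_{i∈v}. -/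

import Mathlib

open MeasureTheory Finset
open scoped ENNReal

noncomputable section

/-- The `j`-th binary digit (`j ≥ 1`) of a real number `x ∈ [0,1)`
(using the binary expansion in which infinitely many digits are `0`). -/
def bdigit (x : ℝ) (j : ℕ) : ℕ := ⌊x * 2 ^ j⌋.toNat % 2

/-- The `k`-th (dyadic) Walsh function. -/
def walsh (k : ℕ) (x : ℝ) : ℝ :=
  (-1 : ℝ) ^ (∑ j ∈ Finset.range k, if k.testBit j then bdigit x (j + 1) else 0)

/-- The multi-dimensional Walsh function. -/
def walshV {s : ℕ} (k : Fin s → ℕ) (x : Fin s → ℝ) : ℝ := ∏ i, walsh (k i) (x i)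

/-- The half-open unit cube `[0,1)^s`. -/
def unitCube (s : ℕ) : Set (Fin s → ℝ) := Set.univ.pi fun _ => Set.Ico (0 : ℝ) 1

/-- The closed unit cube `[0,1]^s`. -/
def closedCube (s : ℕ) : Set (Fin s → ℝ) := Set.univ.pi fun _ => Set.Icc (0 : ℝ) 1

/-- The `k`-th Walsh coefficient of `f`. -/
def walshCoeff {s : ℕ} (f : (Fin s → ℝ) → ℝ) (k : Fin s → ℕ) : ℝ :=
  ∫ x in unitCube s, f x * walshV k x

/-- `z ⊕ 2^{-n}` : flipping the `n`-th binary digit of `z`. -/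
def oplus (z : ℝ) (n : ℕ) : ℝ := z + (-1) ^ bdigit z n * ((2 : ℝ) ^ n)⁻¹

/-- The dyadic difference `∂_{i,n}`. -/
def dyadicDiff {s : ℕ} (i : Fin s) (n : ℕ) (g : (Fin s → ℝ) → ℝ) (x : Fin s → ℝ) : ℝ :=
  2 ^ n * (g (Function.update x i (oplus (x i) n)) - g x)

/-- The function `χ_n`. -/
def chi (n : ℕ) (x y : ℝ) : ℝ :=
  if min x (oplus x n) ≤ y ∧ y ≤ max x (oplus x n) then 2 ^ n else 0

/-- The exponents in the binary expansion of `k`, in decreasing order. -/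
def bitsDesc (k : ℕ) : List ℕ := ((List.range k).filter fun j => k.testBit j).reverse

/-- The number `N` of nonzero binary digits of `k`. -/
def numBits (k : ℕ) : ℕ := (bitsDesc k).length

/-- The weight `μ'_u(k) = ∑_{j=1}^{min(u,N)} (a_j + 2)` for scalar `k`. -/
def muW (u k : ℕ) : ℕ := (((bitsDesc k).take u).map (· + 2)).sum

/-- The weight `μ'_u(k)` for vectors. -/
def muWV {s : ℕ} (u k : Fin s → ℕ) : ℕ := ∑ i, muW (u i) (k i)

/-- `k_{≤}^{u}` : the `u` most significant binary digits of `k`. -/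
def kLe (u k : ℕ) : ℕ := (((bitsDesc k).take u).map (2 ^ ·)).sum

/-- `k_{>}^{u}` : the remaining binary digits of `k`. -/
def kGt (u k : ℕ) : ℕ := (((bitsDesc k).drop u).map (2 ^ ·)).sum

/-- The functions `W(k)`, defined inductively by stripping the least significant
binary digit of `k` (whose exponent is the 2-adic valuation of `k`). -/
def Wfun : ℕ → ℝ → ℝ
  | 0 => fun _ => 1
  | (k + 1) => fun y =>
      ∫ x in Set.Ico (0 : ℝ) 1,
        chi ((k + 1).factorization 2 + 1) x y *
          Wfun ((k + 1) - 2 ^ ((k + 1).factorization 2)) x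
  decreasing_by exact Nat.sub_lt (Nat.succ_pos k) (Nat.two_pow_pos _)

/-- Composition of the dyadic differences `∂_{i,a+1}` for `a` running over a list. -/
def dCompCoord {s : ℕ} (i : Fin s) (L : List ℕ) (g : (Fin s → ℝ) → ℝ) : (Fin s → ℝ) → ℝ :=
  L.foldr (fun a h => dyadicDiff i (a + 1) h) g

/-- The operator `d_{k_u}` : composition over all coordinates `i` of the dyadic
differences `∂_{i,a_{i,j}+1}`, `1 ≤ j ≤ min(u_i, N_i)`. -/
def dComp {s : ℕ} (u k : Fin s → ℕ) (f : (Fin s → ℝ) → ℝ) : (Fin s → ℝ) → ℝ :=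
  (List.finRange s).foldr (fun i g => dCompCoord i ((bitsDesc (k i)).take (u i)) g) f

/-- The multi-index `ν` increased by one in coordinate `i`. -/
def addE {s : ℕ} (i : Fin s) (ν : Fin s → ℕ) : Fin s → ℕ := Function.update ν i (ν i + 1)

/-- `D` is a family of mixed partial derivatives of `f`, of orders up to `u_i` in
the variable `x_i`, each continuous on the closed cube `[0,1]^s`. -/
def HasMixedDerivs {s : ℕ} (u : Fin s → ℕ) (f : (Fin s → ℝ) → ℝ)
    (D : (Fin s → ℕ) → (Fin s → ℝ) → ℝ) : Prop :=
  D (fun _ => 0) = f ∧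
    (∀ ν : Fin s → ℕ, (∀ j, ν j ≤ u j) → ContinuousOn (D ν) (closedCube s)) ∧
    ∀ (ν : Fin s → ℕ) (i : Fin s), (∀ j, addE i ν j ≤ u j) →
      ∀ x ∈ closedCube s,
        HasDerivWithinAt (fun t => D ν (Function.update x i t)) (D (addE i ν) x)
          (Set.Icc 0 1) (x i)

/-- `∫_{[0,1)^{s-|v|}} F dx_{S∖v}` : the inner integral over the coordinates outside `v`
(as a function of the coordinates in `v`). -/
def projInt {s : ℕ} (v : Finset (Fin s)) (F : (Fin s → ℝ) → ℝ) (x : Fin s → ℝ) : ℝ :=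
  ∫ y in unitCube s, F fun i => if i ∈ v then x i else y i

/-- The mixed norm `‖F^{(·)}‖_p` : the `L^p` norm (over the coordinates in `v`) of the
integral of `F` over the coordinates outside `v`. -/
def mixedNorm {s : ℕ} (p : ℝ≥0∞) (v : Finset (Fin s)) (F : (Fin s → ℝ) → ℝ) : ℝ≥0∞ :=
  eLpNorm (projInt v F) p (volume.restrict (unitCube s))

/-- The `ℓ^q` norm of a finite family in `ℝ≥0∞`, with the usual modification at `q = ∞`. -/
def lqNorm {ι : Type*} [Fintype ι] (q : ℝ≥0∞) (a : ι → ℝ≥0∞) : ℝ≥0∞ :=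
  if q = ∞ then ⨆ i, a i else (∑ i, a i ^ q.toReal) ^ q.toReal⁻¹

/-- The `h`-th point of the digital net generated by the matrices `C i`. -/
def netPoint {s m n : ℕ} (C : Fin s → Matrix (Fin n) (Fin m) (ZMod 2)) (h : Fin (2 ^ m)) :
    Fin s → ℝ :=
  fun i => ∑ j : Fin n,
    (((∑ l : Fin m, (if (h : ℕ).testBit (l : ℕ) then (1 : ZMod 2) else 0) * C i j l).val : ℝ) *
      ((2 : ℝ) ^ ((j : ℕ) + 1))⁻¹)

/-- Membership of `k ∈ ℕ₀^s` in the dual net `P^⊥`. -/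
def inDual {s m n : ℕ} (C : Fin s → Matrix (Fin n) (Fin m) (ZMod 2)) (k : Fin s → ℕ) : Prop :=
  ∀ l : Fin m, ∑ i, ∑ j : Fin n, C i j l * (if (k i).testBit (j : ℕ) then (1 : ZMod 2) else 0) = 0

open Classical in
/-- `∑_{k_v ∈ P_v^⊥} 2^{-μ'_α(k_v)}`, encoded as a sum over all `k ∈ ℕ₀^s`
with support exactly `v` lying in the dual net. -/
def dualSum {s m n : ℕ} (α : ℕ) (C : Fin s → Matrix (Fin n) (Fin m) (ZMod 2))
    (v : Finset (Fin s)) : ℝ≥0∞ :=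
  ∑' k : Fin s → ℕ,
    if (∀ i, i ∈ v ↔ k i ≠ 0) ∧ inDual C k
    then (2 : ℝ≥0∞) ^ (-(muWV (fun _ => α) k : ℝ)) else 0


/-- The product of the Rademacher functions whose indices are listed in `L`. -/
def walshList (L : List ℕ) (x : ℝ) : ℝ := (L.map fun a => (-1 : ℝ) ^ bdigit x (a + 1)).prod

lemma abs_walshList (L : List ℕ) (x : ℝ) : |walshList L x| = 1 := by
  induction L with
  | nil => simp [walshList]
  | cons b L ih =>
    simp only [walshList, List.map_cons, List.prod_cons, abs_mul, abs_pow, abs_neg, abs_one,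
      one_pow, one_mul] at ih ⊢
    exact ih

lemma walshList_cons (b : ℕ) (L : List ℕ) (x : ℝ) :
    walshList (b :: L) x = (-1 : ℝ) ^ bdigit x (b + 1) * walshList L x := by
  simp [walshList]

lemma measurable_walshList (L : List ℕ) : Measurable (walshList L) := by
  induction L with
  | nil => exact measurable_const
  | cons b L ih =>
    have h : Measurable fun x : ℝ => (-1 : ℝ) ^ bdigit x (b + 1) := by
      have h1 : Measurable fun x : ℝ => ⌊x * 2 ^ (b + 1)⌋ :=
        Int.measurable_floor.comp (measurable_id.mul_const _)
      exact (measurable_from_top (f := fun n : ℤ => (-1 : ℝ) ^ (n.toNat % 2))).comp h1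
    rw [funext (walshList_cons b L)]
    exact h.mul ih

lemma floor_mul_two_pow_congr {x y : ℝ} {c d : ℕ} (hdc : d ≤ c)
    (h : ⌊x * 2 ^ c⌋ = ⌊y * 2 ^ c⌋) : ⌊x * 2 ^ d⌋ = ⌊y * 2 ^ d⌋ := by
  have key (z : ℝ) : ⌊z * 2 ^ d⌋ = ⌊z * 2 ^ c⌋ / ((2 ^ (c - d) : ℕ) : ℤ) := by
    rw [← Int.floor_div_natCast]
    congr 1
    rw [eq_div_iff (by positivity)]
    push_cast
    rw [mul_assoc, ← pow_add, Nat.add_sub_cancel' hdc]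
  rw [key, key, h]

lemma walshList_congr {L : List ℕ} {c : ℕ} (hL : ∀ a ∈ L, a < c) {x y : ℝ}
    (h : ⌊x * 2 ^ c⌋ = ⌊y * 2 ^ c⌋) : walshList L x = walshList L y := by
  unfold walshList
  congr 1
  refine List.map_congr_left fun a ha => ?_
  simp only [bdigit]
  rw [floor_mul_two_pow_congr (hL a ha) h]

lemma walsh_eq_walshList (k : ℕ) (x : ℝ) : walsh k x = walshList (bitsDesc k) x := by
  have key (l : List ℕ) : ((l.filter fun j => k.testBit j).map
      fun a => (-1 : ℝ) ^ bdigit x (a + 1)).prod =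
      (l.map fun j => (-1 : ℝ) ^ (if k.testBit j then bdigit x (j + 1) else 0)).prod := by
    induction l with
    | nil => simp
    | cons b l ih => by_cases hb : k.testBit b <;> simp [hb, ih]
  unfold walsh walshList bitsDesc
  rw [List.map_reverse, List.prod_reverse, key, ← Finset.prod_pow_eq_pow_sum]
  rfl

lemma abs_walsh (k : ℕ) (x : ℝ) : |walsh k x| = 1 := by
  rw [walsh_eq_walshList, abs_walshList]

lemma measurable_walsh (k : ℕ) : Measurable (walsh k) := by
  rw [funext (walsh_eq_walshList k)]
  exact measurable_walshList _

lemma pairwise_bitsDesc (k : ℕ) : (bitsDesc k).Pairwise (· > ·) := by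
  unfold bitsDesc
  rw [List.pairwise_reverse]
  exact List.pairwise_lt_range.filter _

/-- The primitive of `T` composed with the distance to `2⁻ᵇ ℤ`. -/
def foldWave (b : ℕ) (T : ℝ → ℝ) (x : ℝ) : ℝ :=
  ∫ t in (0 : ℝ)..‖(x : AddCircle ((2 : ℝ) ^ b)⁻¹)‖, T t

/-- An even, continuous, nonnegative function of period `2⁻ᵃ` with mean `A` and values at
most `2 * A`. -/
structure IsWave (a : ℕ) (A : ℝ) (T : ℝ → ℝ) : Prop where
  continuous : Continuous T
  even : ∀ x, T (-x) = T x
  periodic : Function.Periodic T ((2 : ℝ) ^ a)⁻¹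
  nonneg : ∀ x, 0 ≤ T x
  le : ∀ x, T x ≤ 2 * A
  integral : ∫ x in (0 : ℝ)..((2 : ℝ) ^ a)⁻¹, T x = ((2 : ℝ) ^ a)⁻¹ * A

lemma isWave_one (a : ℕ) : IsWave a 1 fun _ => 1 where
  continuous := continuous_const
  even _ := rfl
  periodic _ := rfl
  nonneg _ := zero_le_one
  le _ := by norm_num
  integral := by simp

lemma inv_two_pow_eq (b : ℕ) : ((2 : ℝ) ^ b)⁻¹ = 2 * ((2 : ℝ) ^ (b + 1))⁻¹ := by
  rw [pow_succ]; field_simp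

namespace IsWave

variable {a b : ℕ} {A : ℝ} {T : ℝ → ℝ}

lemma coarsen_succ (h : IsWave (a + 1) A T) : IsWave a A T where
  continuous := h.continuous
  even := h.even
  periodic := by
    have h2 := h.periodic.nat_mul 2
    rw [inv_two_pow_eq a]
    exact_mod_cast h2
  nonneg := h.nonneg
  le := h.le
  integral := by
    have h1 := h.periodic.intervalIntegral_add_eq ((2 : ℝ) ^ (a + 1))⁻¹ 0
    have e : ((2 : ℝ) ^ (a + 1))⁻¹ + ((2 : ℝ) ^ (a + 1))⁻¹ = ((2 : ℝ) ^ a)⁻¹ := by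
      rw [inv_two_pow_eq a]; ring
    rw [e, zero_add, h.integral] at h1
    rw [← intervalIntegral.integral_add_adjacent_intervals
      (h.continuous.intervalIntegrable 0 ((2 : ℝ) ^ (a + 1))⁻¹)
      (h.continuous.intervalIntegrable _ _), h1, h.integral, ← e]
    ring

lemma coarsen (h : IsWave a A T) (hba : b ≤ a) : IsWave b A T := by
  induction hba using Nat.decreasingInduction with
  | self => exact h
  | of_succ _ _ ih => exact ih.coarsen_succ

lemma integral_zero_one (h : IsWave a A T) : ∫ x in (0 : ℝ)..1, T x = A := by
  simpa using (h.coarsen (Nat.zero_le a)).integral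

lemma norm_coe_eq_abs_sub (b : ℕ) {x : ℝ} (n : ℤ)
    (h : |x - n * ((2 : ℝ) ^ b)⁻¹| ≤ ((2 : ℝ) ^ (b + 1))⁻¹) :
    ‖(x : AddCircle ((2 : ℝ) ^ b)⁻¹)‖ = |x - n * ((2 : ℝ) ^ b)⁻¹| := by
  have hp : (0 : ℝ) < ((2 : ℝ) ^ b)⁻¹ := by positivity
  have e : ((x - n * ((2 : ℝ) ^ b)⁻¹ : ℝ) : AddCircle ((2 : ℝ) ^ b)⁻¹) = x := by
    rw [← zsmul_eq_mul, AddCircle.coe_sub, AddCircle.coe_zsmul, AddCircle.coe_period]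
    simp
  rw [← e, AddCircle.norm_coe_eq_abs_iff _ hp.ne', abs_of_pos hp]
  linarith [inv_two_pow_eq b]

lemma norm_coe_le (b : ℕ) (x : ℝ) :
    ‖(x : AddCircle ((2 : ℝ) ^ b)⁻¹)‖ ≤ ((2 : ℝ) ^ (b + 1))⁻¹ := by
  have hp : (0 : ℝ) < ((2 : ℝ) ^ b)⁻¹ := by positivity
  have := AddCircle.norm_le_half_period ((2 : ℝ) ^ b)⁻¹ (x := x) hp.ne'
  rw [abs_of_pos hp] at this
  linarith [inv_two_pow_eq b]

lemma continuous_primitive (h : IsWave a A T) : Continuous fun y => ∫ t in (0 : ℝ)..y, T t :=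
  intervalIntegral.continuous_primitive (fun _ _ => h.continuous.intervalIntegrable _ _) 0

lemma integral_primitive (h : IsWave a A T) :
    ∫ y in (0 : ℝ)..((2 : ℝ) ^ a)⁻¹, (∫ t in (0 : ℝ)..y, T t) =
      (((2 : ℝ) ^ a)⁻¹) ^ 2 * A / 2 := by
  set H := ((2 : ℝ) ^ a)⁻¹ with hH
  have hrefl (y : ℝ) : (∫ t in (0 : ℝ)..(H - y), T t) = H * A - ∫ t in (0 : ℝ)..y, T t := by
    have h1 : (∫ t in (0 : ℝ)..(H - y), T t) = ∫ t in y..H, T t := by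
      have h2 := intervalIntegral.integral_comp_sub_left (a := y) (b := H) T H
      rw [sub_self] at h2
      rw [← h2]
      refine intervalIntegral.integral_congr fun t _ => ?_
      have h3 := h.periodic (-t)
      rw [h.even] at h3
      rw [← h3]
      congr 1
      ring
    rw [h1, ← h.integral, ← hH, eq_sub_iff_add_eq, add_comm]
    exact intervalIntegral.integral_add_adjacent_intervals
      (h.continuous.intervalIntegrable _ _) (h.continuous.intervalIntegrable _ _)
  have h4 := intervalIntegral.integral_comp_sub_left (a := 0) (b := H)
    (fun y => ∫ t in (0 : ℝ)..y, T t) H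
  simp only [hrefl, sub_zero, sub_self] at h4
  rw [intervalIntegral.integral_sub (by simp)
    (h.continuous_primitive.intervalIntegrable _ _)] at h4
  simp only [intervalIntegral.integral_const, sub_zero, smul_eq_mul] at h4
  linarith [h4, sq H]

lemma fold (h : IsWave a A T) (hba : b < a) :
    IsWave b (A * ((2 : ℝ) ^ (b + 2))⁻¹) (foldWave b T) where
  continuous := h.continuous_primitive.comp
    (continuous_norm.comp (AddCircle.continuous_mk' _))
  even x := by
    unfold foldWave
    rw [AddCircle.coe_neg, norm_neg]
  periodic x := by
    unfold foldWave
    rw [AddCircle.coe_add_period]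
  nonneg x := intervalIntegral.integral_nonneg (norm_nonneg _) fun t _ => h.nonneg t
  le x := by
    have h1 := (h.coarsen hba).integral
    have h2 : foldWave b T x ≤ ∫ t in (0 : ℝ)..((2 : ℝ) ^ (b + 1))⁻¹, T t :=
      intervalIntegral.integral_mono_interval le_rfl (norm_nonneg _) (norm_coe_le b x)
        (Filter.Eventually.of_forall h.nonneg) (h.continuous.intervalIntegrable _ _)
    rw [h1] at h2
    refine h2.trans (le_of_eq ?_)
    rw [inv_two_pow_eq (b + 1)]
    ring
  integral := by
    set H := ((2 : ℝ) ^ (b + 1))⁻¹ with hH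
    have hH0 : 0 < H := by positivity
    have e : ((2 : ℝ) ^ b)⁻¹ = 2 * H := inv_two_pow_eq b
    have hc : Continuous (foldWave b T) := h.continuous_primitive.comp
      (continuous_norm.comp (AddCircle.continuous_mk' _))
    have h1 := (h.coarsen hba).integral_primitive
    rw [← hH] at h1
    have hl : ∫ x in (0 : ℝ)..H, foldWave b T x = H ^ 2 * A / 2 := by
      rw [← h1]
      refine intervalIntegral.integral_congr fun x hx => ?_
      rw [Set.uIcc_of_le hH0.le] at hx
      have h2 := norm_coe_eq_abs_sub b (x := x) 0
        (by simpa [abs_of_nonneg hx.1] using hx.2)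
      simp only [foldWave]
      rw [h2]
      simp [abs_of_nonneg hx.1]
    have hr : ∫ x in H..(2 * H), foldWave b T x = H ^ 2 * A / 2 := by
      have h3 := intervalIntegral.integral_comp_sub_left (a := 0) (b := H) (foldWave b T) (2 * H)
      rw [sub_zero, show 2 * H - H = H by ring] at h3
      rw [← h3, ← hl]
      refine intervalIntegral.integral_congr fun x _ => ?_
      simp only [foldWave, ← e]
      rw [AddCircle.coe_sub, AddCircle.coe_period, zero_sub, norm_neg]
    rw [e, ← intervalIntegral.integral_add_adjacent_intervals
      (hc.intervalIntegrable 0 H) (hc.intervalIntegrable _ _), hl, hr]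
    have e2 : ((2 : ℝ) ^ (b + 2))⁻¹ = H / 2 := by
      have := inv_two_pow_eq (b + 1)
      rw [← hH] at this
      linarith
    rw [e2]
    ring

end IsWave

lemma eventually_floor_eq_nhdsGT (c : ℕ) (x : ℝ) :
    ∀ᶠ y in nhdsWithin x (Set.Ioi x), ⌊y * 2 ^ c⌋ = ⌊x * 2 ^ c⌋ := by
  have hx : x < (⌊x * 2 ^ c⌋ + 1) / 2 ^ c := by
    rw [lt_div_iff₀ (by positivity)]
    exact Int.lt_floor_add_one _
  filter_upwards [Ioo_mem_nhdsGT hx] with y hy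
  rw [Int.floor_eq_iff]
  refine ⟨(Int.floor_le _).trans ?_, (lt_div_iff₀ (by positivity)).1 hy.2⟩
  exact mul_le_mul_of_nonneg_right hy.1.le (by positivity)

lemma eventually_floor_eq_nhds {c : ℕ} {x : ℝ} (hx : (⌊x * 2 ^ c⌋ : ℝ) ≠ x * 2 ^ c) :
    ∀ᶠ y in nhds x, ⌊y * 2 ^ c⌋ = ⌊x * 2 ^ c⌋ := by
  have hc : Filter.Tendsto (fun y : ℝ => y * 2 ^ c) (nhds x) (nhds (x * 2 ^ c)) :=
    (continuous_id.mul continuous_const).tendsto x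
  filter_upwards [hc (Ioo_mem_nhds (lt_of_le_of_ne (Int.floor_le _) hx)
    (Int.lt_floor_add_one _))] with y hy
  rw [Int.floor_eq_iff]
  exact ⟨hy.1.le, hy.2⟩

lemma foldWave_int_mul (b : ℕ) (T : ℝ → ℝ) (n : ℤ) : foldWave b T (n * ((2 : ℝ) ^ b)⁻¹) = 0 := by
  unfold foldWave
  rw [← zsmul_eq_mul, AddCircle.coe_zsmul, AddCircle.coe_period]
  simp

namespace IsWave

variable {a b : ℕ} {A : ℝ} {T : ℝ → ℝ} {L : List ℕ}

lemma continuous_walshList_mul_foldWave (h : IsWave a A T) (hba : b < a) (hL : ∀ c ∈ L, c < b) :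
    Continuous fun y => walshList L y * foldWave b T y := by
  have hF := (h.fold hba).continuous
  rw [continuous_iff_continuousAt]
  intro x
  by_cases hx : (⌊x * 2 ^ b⌋ : ℝ) = x * 2 ^ b
  · have h0 : foldWave b T x = 0 := by
      rw [← foldWave_int_mul b T ⌊x * 2 ^ b⌋, hx]
      congr 1
      field_simp
    show Filter.Tendsto _ _ (nhds (walshList L x * foldWave b T x))
    rw [h0, mul_zero]
    have h1 := (hF.tendsto x).abs
    rw [h0, abs_zero] at h1
    refine squeeze_zero_norm (fun y => ?_) h1
    rw [Real.norm_eq_abs, abs_mul, abs_walshList, one_mul]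
  · refine (hF.continuousAt.const_mul (walshList L x)).congr ?_
    filter_upwards [eventually_floor_eq_nhds hx] with y hy
    rw [walshList_congr hL hy]

lemma hasDerivWithinAt_walshList_mul_foldWave (h : IsWave a A T) (hba : b < a)
    (hL : ∀ c ∈ L, c < b) {x : ℝ} (hx : 0 ≤ x) :
    HasDerivWithinAt (fun y => walshList L y * foldWave b T y) (walshList (b :: L) x * T x)
      (Set.Ioi x) x := by
  set H := ((2 : ℝ) ^ (b + 1))⁻¹ with hH
  have hH0 : 0 < H := by positivity
  have hp : ((2 : ℝ) ^ b)⁻¹ = 2 * H := inv_two_pow_eq b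
  have hS (y : ℝ) : HasDerivAt (fun u => ∫ t in (0 : ℝ)..u, T t) (T y) y :=
    (h.continuous.integral_hasStrictDerivAt 0 y).hasDerivAt
  have hper := (h.coarsen hba.le).periodic
  set N := ⌊x * 2 ^ (b + 1)⌋ with hN
  have hN0 : 0 ≤ N := Int.floor_nonneg.2 (by positivity)
  have hbound (y : ℝ) (hy : ⌊y * 2 ^ (b + 1)⌋ = N) : N * H ≤ y ∧ y < (N + 1) * H := by
    rw [Int.floor_eq_iff] at hy
    rw [hH, ← div_eq_mul_inv, ← div_eq_mul_inv]
    exact ⟨(div_le_iff₀ (by positivity)).2 hy.1, (lt_div_iff₀ (by positivity)).2 hy.2⟩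
  have hW (y : ℝ) (hy : ⌊y * 2 ^ (b + 1)⌋ = N) : walshList L y = walshList L x :=
    walshList_congr (c := b + 1) (fun c hc => (hL c hc).trans (Nat.lt_succ_self b)) hy
  have hdig : bdigit x (b + 1) = N.toNat % 2 := rfl
  obtain ⟨m, hm⟩ | ⟨m, hm⟩ := Int.even_or_odd N
  · have hF (y : ℝ) (hy : ⌊y * 2 ^ (b + 1)⌋ = N) :
        foldWave b T y = ∫ t in (0 : ℝ)..(y - m * ((2 : ℝ) ^ b)⁻¹), T t := by
      have h1 := hbound y hy
      have h2 : y - m * ((2 : ℝ) ^ b)⁻¹ = y - N * H := by rw [hp, hm]; push_cast; ring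
      have h3 : |y - m * ((2 : ℝ) ^ b)⁻¹| = y - m * ((2 : ℝ) ^ b)⁻¹ :=
        abs_of_nonneg (by rw [h2]; linarith)
      unfold foldWave
      rw [norm_coe_eq_abs_sub b m (by rw [h3, h2]; linarith), h3]
    have hsgn : (-1 : ℝ) ^ bdigit x (b + 1) = 1 := by
      rw [hdig, show N.toNat % 2 = 0 by omega, pow_zero]
    have hT : T (x - m * ((2 : ℝ) ^ b)⁻¹) = T x := hper.sub_int_mul_eq m
    have hd := (((hS (x - m * ((2 : ℝ) ^ b)⁻¹)).comp_sub_const x _).const_mul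
      (walshList L x)).hasDerivWithinAt (s := Set.Ioi x)
    rw [walshList_cons, hsgn, one_mul]
    rw [hT] at hd
    refine hd.congr_of_eventuallyEq ?_ ?_
    · filter_upwards [eventually_floor_eq_nhdsGT (b + 1) x] with y hy
      rw [hW y hy, hF y hy]
    · rw [hF x rfl]
  · have hF (y : ℝ) (hy : ⌊y * 2 ^ (b + 1)⌋ = N) :
        foldWave b T y = ∫ t in (0 : ℝ)..((m + 1 : ℤ) * ((2 : ℝ) ^ b)⁻¹ - y), T t := by
      have h1 := hbound y hy
      have h2 : (m + 1 : ℤ) * ((2 : ℝ) ^ b)⁻¹ - y = (N + 1) * H - y := by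
        rw [hp, hm]; push_cast; ring
      have h3 : |y - (m + 1 : ℤ) * ((2 : ℝ) ^ b)⁻¹| = (m + 1 : ℤ) * ((2 : ℝ) ^ b)⁻¹ - y := by
        rw [abs_sub_comm]
        exact abs_of_nonneg (by rw [h2]; linarith)
      unfold foldWave
      rw [norm_coe_eq_abs_sub b (m + 1) (by rw [h3, h2]; linarith), h3]
    have hsgn : (-1 : ℝ) ^ bdigit x (b + 1) = -1 := by
      rw [hdig, show N.toNat % 2 = 1 by omega, pow_one]
    have hT : T ((m + 1 : ℤ) * ((2 : ℝ) ^ b)⁻¹ - x) = T x := by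
      rw [← h.even, neg_sub]
      exact hper.sub_int_mul_eq _
    have hd := (((hS ((m + 1 : ℤ) * ((2 : ℝ) ^ b)⁻¹ - x)).comp_const_sub _ x).const_mul
      (walshList L x)).hasDerivWithinAt (s := Set.Ioi x)
    rw [walshList_cons, hsgn, neg_one_mul, neg_mul, ← mul_neg]
    rw [hT] at hd
    refine hd.congr_of_eventuallyEq ?_ ?_
    · filter_upwards [eventually_floor_eq_nhdsGT (b + 1) x] with y hy
      rw [hW y hy, hF y hy]
    · rw [hF x rfl]

lemma integral_mul_walshList_mul (h : IsWave a A T) (hba : b < a) (hL : ∀ c ∈ L, c < b)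
    {g g' : ℝ → ℝ} (hg' : ContinuousOn g' (Set.Icc 0 1))
    (hg : ∀ x ∈ Set.Icc (0 : ℝ) 1, HasDerivWithinAt g (g' x) (Set.Icc 0 1) x) :
    ∫ x in (0 : ℝ)..1, g x * (walshList (b :: L) x * T x) =
      -∫ x in (0 : ℝ)..1, g' x * (walshList L x * foldWave b T x) := by
  have h01 : (0 : ℝ) ≤ 1 := zero_le_one
  have key := intervalIntegral.integral_mul_deriv_eq_deriv_mul_of_hasDeriv_right
    (a := 0) (b := 1) (u := g) (u' := g') (v := fun y => walshList L y * foldWave b T y)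
    (v' := fun x => walshList (b :: L) x * T x)
    (by rw [Set.uIcc_of_le h01]; exact fun x hx => (hg x hx).continuousWithinAt)
    (h.continuous_walshList_mul_foldWave hba hL).continuousOn
    (fun x hx => by
      rw [min_eq_left h01, max_eq_right h01] at hx
      exact ((hg x ⟨hx.1.le, hx.2.le⟩).hasDerivAt (Icc_mem_nhds hx.1 hx.2)).hasDerivWithinAt)
    (fun x hx => by
      rw [min_eq_left h01] at hx
      exact h.hasDerivWithinAt_walshList_mul_foldWave hba hL hx.1.le)
    (ContinuousOn.intervalIntegrable (by rwa [Set.uIcc_of_le h01]))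
    (by
      rw [intervalIntegrable_iff]
      refine (intervalIntegrable_iff.1 (h.continuous.intervalIntegrable 0 1)).bdd_mul (c := 1)
        (measurable_walshList _).aestronglyMeasurable (Filter.Eventually.of_forall fun x => ?_)
      rw [Real.norm_eq_abs, abs_walshList])
  have h0 : foldWave b T 0 = 0 := by simpa using foldWave_int_mul b T 0
  have h1 : foldWave b T 1 = 0 := by
    rw [← foldWave_int_mul b T (2 ^ b)]
    congr 1
    push_cast
    field_simp
  rw [key, h0, h1]
  simp

/-- Iterated integration by parts against a product of Rademacher functions and a wave. -/
lemma exists_kernel (n : ℕ) : ∀ {a : ℕ} {A : ℝ} {T : ℝ → ℝ} {L : List ℕ}, IsWave a A T →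
    (∀ c ∈ L, c < a) → L.Pairwise (· > ·) → n ≤ L.length →
    ∃ K : ℝ → ℝ, Measurable K ∧
      (∀ x, |K x| ≤ 2 * (A * ((2 : ℝ) ^ ((L.take n).map (· + 2)).sum)⁻¹)) ∧
      ∫ x in (0 : ℝ)..1, |K x| = A * ((2 : ℝ) ^ ((L.take n).map (· + 2)).sum)⁻¹ ∧
      ∀ G : ℕ → ℝ → ℝ, (∀ j ≤ n, ContinuousOn (G j) (Set.Icc 0 1)) →
        (∀ j < n, ∀ x ∈ Set.Icc (0 : ℝ) 1,
          HasDerivWithinAt (G j) (G (j + 1) x) (Set.Icc 0 1) x) →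
        ∫ x in (0 : ℝ)..1, G 0 x * (walshList L x * T x) =
          ∫ x in (0 : ℝ)..1, G n x * K x := by
  induction n with
  | zero =>
    intro a A T L h _ _ _
    have habs (x : ℝ) : |walshList L x * T x| = T x := by
      rw [abs_mul, abs_walshList, one_mul, abs_of_nonneg (h.nonneg x)]
    refine ⟨fun x => walshList L x * T x, (measurable_walshList L).mul h.continuous.measurable,
      fun x => ?_, ?_, fun G _ _ => rfl⟩
    · simpa [habs] using h.le x
    · simpa [habs] using h.integral_zero_one
  | succ n ih =>
    intro a A T L h hL hpw hn
    obtain _ | ⟨b, L⟩ := L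
    · simp at hn
    rw [List.pairwise_cons] at hpw
    have hba : b < a := hL b List.mem_cons_self
    obtain ⟨K, hKm, hKle, hKint, hK⟩ := ih (h.fold hba) hpw.1 hpw.2 (by simpa using hn)
    have hA : A * ((2 : ℝ) ^ (b + 2))⁻¹ * ((2 : ℝ) ^ ((L.take n).map (· + 2)).sum)⁻¹ =
        A * ((2 : ℝ) ^ (((b :: L).take (n + 1)).map (· + 2)).sum)⁻¹ := by
      rw [List.take_succ_cons, List.map_cons, List.sum_cons, pow_add _ (b + 2), mul_inv, mul_assoc]
    rw [hA] at hKint hKle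
    refine ⟨fun x => -K x, hKm.neg, fun x => ?_, ?_, fun G hGc hGd => ?_⟩
    · rw [abs_neg]; exact hKle x
    · simpa only [abs_neg] using hKint
    · rw [h.integral_mul_walshList_mul hba hpw.1 (hGc 1 (by omega)) (hGd 0 (by omega)),
        hK (fun j => G (j + 1)) (fun j hj => hGc _ (by omega)) (fun j hj => hGd _ (by omega)),
        ← intervalIntegral.integral_neg]
      simp only [mul_neg]

end IsWave

/-- The kernel representing the `k`-th Walsh coefficient through the derivative of order
`min u (numBits k)`. -/
lemma exists_walsh_kernel (u k : ℕ) : ∃ K : ℝ → ℝ, Measurable K ∧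
    (∀ x, |K x| ≤ 2 * ((2 : ℝ) ^ muW u k)⁻¹) ∧
    ∫ x in Set.Ico (0 : ℝ) 1, |K x| = ((2 : ℝ) ^ muW u k)⁻¹ ∧
    ∀ G : ℕ → ℝ → ℝ, (∀ j ≤ min u (numBits k), ContinuousOn (G j) (Set.Icc 0 1)) →
      (∀ j < min u (numBits k), ∀ x ∈ Set.Icc (0 : ℝ) 1,
        HasDerivWithinAt (G j) (G (j + 1) x) (Set.Icc 0 1) x) →
      ∫ x in Set.Ico (0 : ℝ) 1, G 0 x * walsh k x =
        ∫ x in Set.Ico (0 : ℝ) 1, G (min u (numBits k)) x * K x := by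
  have hlt : ∀ c ∈ bitsDesc k, c < k := by
    intro c hc
    simp only [bitsDesc, List.mem_reverse, List.mem_filter, List.mem_range] at hc
    exact hc.1
  obtain ⟨K, hKm, hKle, hKint, hK⟩ := IsWave.exists_kernel (min u (numBits k)) (isWave_one k) hlt
    (pairwise_bitsDesc k) (min_le_right _ _)
  have hmu : (((bitsDesc k).take (min u (numBits k))).map (· + 2)).sum = muW u k := by
    unfold muW numBits
    rw [← List.take_eq_take_min]
  have hI (F : ℝ → ℝ) : ∫ x in Set.Ico (0 : ℝ) 1, F x = ∫ x in (0 : ℝ)..1, F x := by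
    rw [integral_Ico_eq_integral_Ioc, intervalIntegral.integral_of_le zero_le_one]
  rw [hmu, one_mul] at hKle hKint
  refine ⟨K, hKm, hKle, by rw [hI]; exact hKint, fun G hGc hGd => ?_⟩
  rw [hI, hI, ← hK G hGc hGd]
  simp only [walsh_eq_walshList, mul_one]

section ProductMeasure

variable {ι : Type*} [Fintype ι] [DecidableEq ι] {X : ι → Type*} [∀ i, MeasurableSpace (X i)]
  (μ : ∀ i, Measure (X i)) [∀ i, IsProbabilityMeasure (μ i)]

lemma measurePreserving_update (i : ι) :
    MeasurePreserving (fun z : (∀ j, X j) × X i => Function.update z.1 i z.2)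
      ((Measure.pi μ).prod (μ i)) (Measure.pi μ) := by
  have hm : Measurable fun z : (∀ j, X j) × X i => Function.update z.1 i z.2 := measurable_update'
  refine ⟨hm, (Measure.pi_eq fun t ht => ?_).symm⟩
  rw [Measure.map_apply hm (MeasurableSet.univ_pi ht)]
  have hpre : (fun z : (∀ j, X j) × X i => Function.update z.1 i z.2) ⁻¹' Set.univ.pi t =
      (Set.univ.pi (Function.update t i Set.univ)) ×ˢ t i := by
    ext z
    simp only [Set.mem_preimage, Set.mem_pi, Set.mem_univ, true_imp_iff, Set.mem_prod]
    constructor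
    · refine fun h => ⟨fun j => ?_, by simpa using h i⟩
      by_cases hj : j = i
      · subst hj; simp
      · simpa [hj] using h j
    · rintro ⟨h1, h2⟩ j
      by_cases hj : j = i
      · subst hj; simpa using h2
      · simpa [hj] using h1 j
  rw [hpre, Measure.prod_prod, Measure.pi_pi, ← Finset.mul_prod_erase _ _ (Finset.mem_univ i),
    ← Finset.mul_prod_erase _ (fun j => μ j (t j)) (Finset.mem_univ i), Function.update_self,
    measure_univ, one_mul, mul_comm]
  congr 1
  refine Finset.prod_congr rfl fun j hj => ?_
  rw [Function.update_of_ne (Finset.ne_of_mem_erase hj)]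

lemma measurePreserving_piecewise (v : Finset ι) :
    MeasurePreserving (fun z : (∀ j, X j) × (∀ j, X j) => fun i => if i ∈ v then z.1 i else z.2 i)
      ((Measure.pi μ).prod (Measure.pi μ)) (Measure.pi μ) := by
  have hm : Measurable fun z : (∀ j, X j) × (∀ j, X j) =>
      fun i => if i ∈ v then z.1 i else z.2 i := by
    refine measurable_pi_lambda _ fun i => ?_
    split_ifs
    · exact (measurable_pi_apply i).comp measurable_fst
    · exact (measurable_pi_apply i).comp measurable_snd
  refine ⟨hm, (Measure.pi_eq fun t ht => ?_).symm⟩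
  rw [Measure.map_apply hm (MeasurableSet.univ_pi ht)]
  have hpre : (fun z : (∀ j, X j) × (∀ j, X j) => fun i => if i ∈ v then z.1 i else z.2 i) ⁻¹'
      Set.univ.pi t = (Set.univ.pi fun i => if i ∈ v then t i else Set.univ) ×ˢ
        (Set.univ.pi fun i => if i ∈ v then Set.univ else t i) := by
    ext z
    simp only [Set.mem_preimage, Set.mem_pi, Set.mem_univ, true_imp_iff, Set.mem_prod,
      ← forall_and]
    refine forall_congr' fun j => ?_
    by_cases hj : j ∈ v <;> simp [hj]
  rw [hpre, Measure.prod_prod, Measure.pi_pi, Measure.pi_pi, ← Finset.prod_mul_distrib]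
  refine Finset.prod_congr rfl fun j _ => ?_
  by_cases hj : j ∈ v <;> simp [hj]

end ProductMeasure

lemma lintegral_enorm_mul_le {Ω : Type*} [MeasurableSpace Ω] {μ : Measure Ω} {P κ : Ω → ℝ}
    (hP : AEStronglyMeasurable P μ) (hκ : Measurable κ) {c d p : ℝ≥0∞} (hp : 1 ≤ p)
    (hc0 : c ≠ 0) (hd0 : d ≠ 0) (hd : d ≠ ∞) (hle : ∀ x, ‖κ x‖ₑ ≤ c * d)
    (hint : ∫⁻ x, ‖κ x‖ₑ ∂μ ≤ d) :
    ∫⁻ x, ‖P x‖ₑ * ‖κ x‖ₑ ∂μ ≤ c ^ (1 / p.toReal) * d * eLpNorm P p μ := by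
  set ν := μ.withDensity fun x => ‖κ x‖ₑ with hν
  have hPν : AEStronglyMeasurable P ν := hP.mono_ac (withDensity_absolutelyContinuous _ _)
  have h1 : ∫⁻ x, ‖P x‖ₑ * ‖κ x‖ₑ ∂μ = eLpNorm P 1 ν := by
    rw [eLpNorm_one_eq_lintegral_enorm, hν,
      lintegral_withDensity_eq_lintegral_mul₀' hκ.enorm.aemeasurable hPν.enorm]
    simp only [Pi.mul_apply, mul_comm]
  have hνle : ν ≤ (c * d) • μ := by
    rw [← withDensity_const]
    exact withDensity_mono (Filter.Eventually.of_forall hle)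
  have huniv : ν Set.univ ≤ d := by
    rwa [hν, withDensity_apply _ MeasurableSet.univ, Measure.restrict_univ]
  have hexp : 0 ≤ 1 / (1 : ℝ≥0∞).toReal - 1 / p.toReal := by
    rcases eq_or_ne p ∞ with rfl | hpt
    · simp
    · have : 1 ≤ p.toReal := by
        simpa using (ENNReal.toReal_le_toReal ENNReal.one_ne_top hpt).2 hp
      simpa using inv_le_one_of_one_le₀ this
  calc ∫⁻ x, ‖P x‖ₑ * ‖κ x‖ₑ ∂μ = eLpNorm P 1 ν := h1
    _ ≤ eLpNorm P p ν * ν Set.univ ^ (1 / (1 : ℝ≥0∞).toReal - 1 / p.toReal) :=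
      eLpNorm_le_eLpNorm_mul_rpow_measure_univ hp hPν
    _ ≤ ((c * d) ^ (1 / p.toReal) * eLpNorm P p μ) *
        d ^ (1 / (1 : ℝ≥0∞).toReal - 1 / p.toReal) := by
      gcongr
      refine (eLpNorm_mono_measure P hνle).trans (le_of_eq ?_)
      rw [eLpNorm_smul_measure_of_ne_zero (mul_ne_zero hc0 hd0), smul_eq_mul, ENNReal.toReal_div,
        ENNReal.toReal_one]
    _ = c ^ (1 / p.toReal) * d * eLpNorm P p μ := by
      have hdd : d ^ (1 / p.toReal) * d ^ (1 / (1 : ℝ≥0∞).toReal - 1 / p.toReal) = d := by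
        rw [← ENNReal.rpow_add _ _ hd0 hd]
        simp
      rw [ENNReal.mul_rpow_of_nonneg _ _ (by positivity)]
      calc _ = c ^ (1 / p.toReal) * (d ^ (1 / p.toReal) *
            d ^ (1 / (1 : ℝ≥0∞).toReal - 1 / p.toReal)) * eLpNorm P p μ := by ring
        _ = _ := by rw [hdd]

instance isProbabilityMeasure_restrict_Ico :
    IsProbabilityMeasure ((volume : Measure ℝ).restrict (Set.Ico 0 1)) :=
  ⟨by simp⟩

lemma restrict_unitCube (s : ℕ) : (volume : Measure (Fin s → ℝ)).restrict (unitCube s) =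
    Measure.pi fun _ => (volume : Measure ℝ).restrict (Set.Ico 0 1) := by
  unfold unitCube
  rw [volume_pi, Measure.restrict_pi_pi]

lemma unitCube_subset_closedCube (s : ℕ) : unitCube s ⊆ closedCube s :=
  Set.pi_mono fun _ _ => Set.Ico_subset_Icc_self

lemma measurableSet_unitCube (s : ℕ) : MeasurableSet (unitCube s) :=
  MeasurableSet.univ_pi fun _ => measurableSet_Ico

lemma update_mem_closedCube {s : ℕ} {x : Fin s → ℝ} (hx : x ∈ closedCube s) (i : Fin s) {t : ℝ}
    (ht : t ∈ Set.Icc (0 : ℝ) 1) : Function.update x i t ∈ closedCube s := by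
  intro j _
  by_cases hj : j = i
  · subst hj; simpa using ht
  · simpa [hj] using hx j (Set.mem_univ j)

lemma measurable_prod_apply {s : ℕ} {q : Fin s → ℝ → ℝ} (hq : ∀ i, Measurable (q i)) :
    Measurable fun x : Fin s → ℝ => ∏ i, q i (x i) :=
  Finset.measurable_prod _ fun i _ => (hq i).comp (measurable_pi_apply i)

lemma abs_prod_apply_le {s : ℕ} {q : Fin s → ℝ → ℝ} {C : Fin s → ℝ} (hC : ∀ i t, |q i t| ≤ C i)
    (x : Fin s → ℝ) : |∏ i, q i (x i)| ≤ ∏ i, C i := by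
  rw [Finset.abs_prod]
  exact Finset.prod_le_prod (fun _ _ => abs_nonneg _) fun i _ => hC i _

lemma integrable_mul_prod {s : ℕ} {F : (Fin s → ℝ) → ℝ} (hF : ContinuousOn F (closedCube s))
    {q : Fin s → ℝ → ℝ} (hq : ∀ i, Measurable (q i)) {C : Fin s → ℝ} (hC : ∀ i t, |q i t| ≤ C i) :
    IntegrableOn (fun x => F x * ∏ i, q i (x i)) (unitCube s) := by
  have h1 : IntegrableOn F (unitCube s) :=
    (hF.integrableOn_compact (isCompact_univ_pi fun _ => isCompact_Icc)).mono_set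
      (unitCube_subset_closedCube s)
  exact h1.mul_bdd (c := ∏ i, C i) (measurable_prod_apply hq).aestronglyMeasurable
    (Filter.Eventually.of_forall (abs_prod_apply_le hC))

lemma integral_unitCube_congr_update {s : ℕ} (i : Fin s) {F H : (Fin s → ℝ) → ℝ}
    (hF : IntegrableOn F (unitCube s)) (hH : IntegrableOn H (unitCube s))
    (h : ∀ x ∈ closedCube s, ∫ t in Set.Ico (0 : ℝ) 1, F (Function.update x i t) =
      ∫ t in Set.Ico (0 : ℝ) 1, H (Function.update x i t)) :
    ∫ x in unitCube s, F x = ∫ x in unitCube s, H x := by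
  have key {F : (Fin s → ℝ) → ℝ} (hF : IntegrableOn F (unitCube s)) :
      ∫ x in unitCube s, F x =
        ∫ x in unitCube s, ∫ t in Set.Ico (0 : ℝ) 1, F (Function.update x i t) := by
    have hmp := measurePreserving_update
      (fun _ : Fin s => (volume : Measure ℝ).restrict (Set.Ico 0 1)) i
    rw [IntegrableOn, restrict_unitCube] at hF
    rw [restrict_unitCube]
    have hF' := hmp.integrable_comp_of_integrable hF
    rw [← integral_prod (fun z : (Fin s → ℝ) × ℝ => F (Function.update z.1 i z.2)) hF']
    conv_lhs => rw [← hmp.map_eq]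
    rw [integral_map hmp.measurable.aemeasurable (by rw [hmp.map_eq]; exact hF.1)]
  rw [key hF, key hH]
  exact setIntegral_congr_fun (measurableSet_unitCube s) fun x hx =>
    h x (unitCube_subset_closedCube s hx)

lemma integral_unitCube_eq_integral_piecewise {s : ℕ} (v : Finset (Fin s)) {F : (Fin s → ℝ) → ℝ}
    (hF : IntegrableOn F (unitCube s)) :
    ∫ x in unitCube s, F x = ∫ x in unitCube s, projInt v F x := by
  have hmp := measurePreserving_piecewise
    (fun _ : Fin s => (volume : Measure ℝ).restrict (Set.Ico 0 1)) v
  unfold projInt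
  rw [IntegrableOn, restrict_unitCube] at hF
  rw [restrict_unitCube]
  have hF' := hmp.integrable_comp_of_integrable hF
  rw [← integral_prod (fun z : (Fin s → ℝ) × (Fin s → ℝ) =>
    F fun i => if i ∈ v then z.1 i else z.2 i) hF']
  conv_lhs => rw [← hmp.map_eq]
  rw [integral_map hmp.measurable.aemeasurable (by rw [hmp.map_eq]; exact hF.1)]

lemma aestronglyMeasurable_projInt {s : ℕ} (v : Finset (Fin s)) {F : (Fin s → ℝ) → ℝ}
    (hF : IntegrableOn F (unitCube s)) :
    AEStronglyMeasurable (projInt v F) (volume.restrict (unitCube s)) := by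
  have hmp := measurePreserving_piecewise
    (fun _ : Fin s => (volume : Measure ℝ).restrict (Set.Ico 0 1)) v
  unfold projInt
  rw [IntegrableOn, restrict_unitCube] at hF
  rw [restrict_unitCube]
  exact (hmp.integrable_comp_of_integrable hF).1.integral_prod_right'

/-- Replacing a one-dimensional factor by a kernel that represents it through a derivative of
order `m` in the corresponding variable. -/
lemma HasMixedDerivs.integral_mul_prod_update {s : ℕ} {u : Fin s → ℕ} {f : (Fin s → ℝ) → ℝ}
    {D : (Fin s → ℕ) → (Fin s → ℝ) → ℝ} (hf : HasMixedDerivs u f D) {ν : Fin s → ℕ}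
    (hν : ∀ j, ν j ≤ u j) {i : Fin s} (hνi : ν i = 0) {m : ℕ} (hm : m ≤ u i)
    {q : Fin s → ℝ → ℝ} (hq : ∀ j, Measurable (q j)) {C : Fin s → ℝ} (hC : ∀ j t, |q j t| ≤ C j)
    {K : ℝ → ℝ} (hKm : Measurable K) {B : ℝ} (hB : ∀ t, |K t| ≤ B)
    (hK : ∀ G : ℕ → ℝ → ℝ, (∀ j ≤ m, ContinuousOn (G j) (Set.Icc 0 1)) →
      (∀ j < m, ∀ x ∈ Set.Icc (0 : ℝ) 1,
        HasDerivWithinAt (G j) (G (j + 1) x) (Set.Icc 0 1) x) →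
      ∫ x in Set.Ico (0 : ℝ) 1, G 0 x * q i x = ∫ x in Set.Ico (0 : ℝ) 1, G m x * K x) :
    ∫ x in unitCube s, D ν x * ∏ j, q j (x j) =
      ∫ x in unitCube s, D (Function.update ν i m) x * ∏ j, Function.update q i K j (x j) := by
  have hupd {j : ℕ} (hj : j ≤ m) : ∀ l, Function.update ν i j l ≤ u l := by
    intro l
    by_cases hl : l = i
    · subst hl; simpa using hj.trans hm
    · simpa [hl] using hν l
  have hprod (q : Fin s → ℝ → ℝ) (x : Fin s → ℝ) (t : ℝ) :
      ∏ j, q j (Function.update x i t j) = q i t * ∏ j ∈ Finset.univ.erase i, q j (x j) := by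
    rw [← Finset.mul_prod_erase _ _ (Finset.mem_univ i), Function.update_self]
    congr 1
    refine Finset.prod_congr rfl fun j hj => ?_
    rw [Function.update_of_ne (Finset.ne_of_mem_erase hj)]
  refine integral_unitCube_congr_update i (integrable_mul_prod (hf.2.1 ν hν) hq hC)
    (integrable_mul_prod (C := Function.update C i B) (hf.2.1 _ (hupd le_rfl)) (fun j => ?_)
      fun j t => ?_) fun x hx => ?_
  · by_cases hj : j = i
    · subst hj; simpa using hKm
    · simpa [hj] using hq j
  · by_cases hj : j = i
    · subst hj; simpa using hB t
    · simpa [hj] using hC j t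
  · have hcont : Continuous (Function.update x i) := continuous_const.update i continuous_id
    have h1 := hK (fun j t => D (Function.update ν i j) (Function.update x i t))
      (fun j hj => (hf.2.1 _ (hupd hj)).comp hcont.continuousOn
        fun t ht => update_mem_closedCube hx i ht)
      (fun j hj t ht => by
        have e : addE i (Function.update ν i j) = Function.update ν i (j + 1) := by
          simp [addE]
        have h2 := hf.2.2 (Function.update ν i j) i (by rw [e]; exact hupd hj)
          (Function.update x i t) (update_mem_closedCube hx i ht)
        simpa [e] using h2)
    have e0 : Function.update ν i 0 = ν := by rw [← hνi, Function.update_eq_self]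
    simp only [e0] at h1
    simp only [hprod, Function.update_self, ← mul_assoc]
    rw [integral_mul_const, integral_mul_const, h1]
    congr 1
    refine Finset.prod_congr rfl fun j hj => ?_
    rw [Function.update_of_ne (Finset.ne_of_mem_erase hj)]

/-- Theorem 2: bound on the Walsh coefficients of a function whose mixed
partial derivatives up to order `α ≥ 2` in each variable are continuous:
`|f̂((k_v;0))| ≤ 2^{|v|/p} ⋅ 2^{-μ'_α(k_v)} ⋅ ‖f^{(min(α,N_{k_v}))}‖_p`. -/
theorem stmt1 {s : ℕ} (hs : 1 ≤ s) (α : ℕ) (hα : 2 ≤ α)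
    (f : (Fin s → ℝ) → ℝ) (D : (Fin s → ℕ) → (Fin s → ℝ) → ℝ)
    (hf : HasMixedDerivs (fun _ => α) f D)
    (p : ℝ≥0∞) (hp : 1 ≤ p)
    (v : Finset (Fin s)) (hv : v.Nonempty)
    (k : Fin s → ℕ) (hk : ∀ i, i ∈ v ↔ k i ≠ 0) :
    ENNReal.ofReal |walshCoeff f k| ≤
      (2 : ℝ≥0∞) ^ ((v.card : ℝ) / p.toReal) *
        (2 : ℝ≥0∞) ^ (-(muWV (fun _ => α) k : ℝ)) *
        mixedNorm p v (D fun i => min α (numBits (k i))) := by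
  choose K hKm hKle hKint hK using fun i => exists_walsh_kernel α (k i)
  set n : Fin s → ℕ := fun i => min α (numBits (k i)) with hn
  set Q : Finset (Fin s) → Fin s → ℝ → ℝ := fun w i => if i ∈ w then K i else walsh (k i) with hQ
  have hQm (w : Finset (Fin s)) (i : Fin s) : Measurable (Q w i) := by
    simp only [hQ]
    split_ifs
    exacts [hKm i, measurable_walsh _]
  have hQle (w : Finset (Fin s)) (i : Fin s) (t : ℝ) :
      |Q w i t| ≤ (if i ∈ w then 2 else 1) * ((2 : ℝ) ^ (if i ∈ w then muW α (k i) else 0))⁻¹ := by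
    simp only [hQ]
    split_ifs
    · exact hKle i t
    · simp [abs_walsh]
  have hcoeff (w : Finset (Fin s)) : walshCoeff f k =
      ∫ x in unitCube s, D (fun i => if i ∈ w then n i else 0) x * ∏ i, Q w i (x i) := by
    induction w using Finset.induction_on with
    | empty =>
      simp only [Finset.notMem_empty, if_false, hf.1, hQ]
      rfl
    | insert i w hi ih =>
      have hν : Function.update (fun i => if i ∈ w then n i else 0) i (n i) =
          fun j => if j ∈ insert i w then n j else 0 := by
        ext j
        by_cases hj : j = i
        · subst hj; simp
        · simp [hj]
      have hQi : Function.update (Q w) i (K i) = Q (insert i w) := by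
        ext j t
        by_cases hj : j = i
        · subst hj; simp [hQ]
        · simp [hQ, hj]
      have hwi : Q w i = walsh (k i) := by simp [hQ, hi]
      rw [ih, hf.integral_mul_prod_update (i := i) (m := n i) (fun j => ?_) (by simp [hi])
        (min_le_left _ _) (hQm w) (hQle w) (hKm i) (hKle i) (by rw [hwi]; exact hK i), hν, hQi]
      split_ifs
      exacts [min_le_left _ _, Nat.zero_le _]
  have hk0 {i : Fin s} (hi : i ∉ v) : k i = 0 := by
    by_contra h
    exact hi ((hk i).2 h)
  have hnv : (fun i => if i ∈ v then n i else 0) = n := by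
    ext i
    by_cases hi : i ∈ v
    · simp [hi]
    · simp [hi, hn, hk0 hi, numBits, bitsDesc]
  have hQone {i : Fin s} (hi : i ∉ v) (t : ℝ) : Q v i t = 1 := by
    simp [hQ, hi, hk0 hi, walsh]
  have hmu : ∑ i, (if i ∈ v then muW α (k i) else 0) = muWV (fun _ => α) k := by
    refine Finset.sum_congr rfl fun i _ => ?_
    by_cases hi : i ∈ v
    · simp [hi]
    · simp [hi, hk0 hi, muW, bitsDesc]
  have hDn : ContinuousOn (D n) (closedCube s) := hf.2.1 _ fun j => min_le_left _ _
  set κ : (Fin s → ℝ) → ℝ := fun x => ∏ i, Q v i (x i) with hκ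
  have hκm : Measurable κ := measurable_prod_apply (hQm v)
  have hDκ : IntegrableOn (fun x => D n x * κ x) (unitCube s) :=
    integrable_mul_prod hDn (hQm v) (hQle v)
  have hDint : IntegrableOn (D n) (unitCube s) :=
    (hDn.integrableOn_compact (isCompact_univ_pi fun _ => isCompact_Icc)).mono_set
      (unitCube_subset_closedCube s)
  have hrep : walshCoeff f k = ∫ x in unitCube s, projInt v (D n) x * κ x := by
    rw [hcoeff v, hnv, integral_unitCube_eq_integral_piecewise v hDκ]
    congr 1
    ext x
    unfold projInt
    rw [← integral_mul_const]
    congr 1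
    ext y
    refine congrArg _ (Finset.prod_congr rfl fun i _ => ?_)
    by_cases hi : i ∈ v
    · simp [hi]
    · rw [hQone hi, hQone hi]
  have hd : ENNReal.ofReal ((2 : ℝ) ^ muWV (fun _ => α) k)⁻¹ =
      (2 : ℝ≥0∞) ^ (-(muWV (fun _ => α) k : ℝ)) := by
    rw [ENNReal.ofReal_inv_of_pos (by positivity), ENNReal.ofReal_pow (by norm_num),
      ENNReal.ofReal_ofNat, ENNReal.rpow_neg, ENNReal.rpow_natCast]
  have hκle (x : Fin s → ℝ) :
      ‖κ x‖ₑ ≤ (2 : ℝ≥0∞) ^ (v.card : ℝ) * (2 : ℝ≥0∞) ^ (-(muWV (fun _ => α) k : ℝ)) := by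
    have h1 := abs_prod_apply_le (hQle v) x
    rw [Finset.prod_mul_distrib, Finset.prod_inv_distrib, Finset.prod_pow_eq_pow_sum, hmu,
      Finset.prod_ite_mem, Finset.univ_inter, Finset.prod_const] at h1
    rw [Real.enorm_eq_ofReal_abs, ← hd, ENNReal.rpow_natCast, ← ENNReal.ofReal_ofNat 2,
      ← ENNReal.ofReal_pow (by norm_num), ← ENNReal.ofReal_mul (by positivity)]
    exact ENNReal.ofReal_le_ofReal h1
  have hκint : ∫⁻ x in unitCube s, ‖κ x‖ₑ ≤ (2 : ℝ≥0∞) ^ (-(muWV (fun _ => α) k : ℝ)) := by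
    have hκi : IntegrableOn κ (unitCube s) := by
      simpa [hκ] using integrable_mul_prod (F := fun _ => 1) continuousOn_const (hQm v) (hQle v)
    rw [← hd, ← ofReal_integral_norm_eq_lintegral_enorm hκi]
    refine ENNReal.ofReal_le_ofReal (le_of_eq ?_)
    simp only [hκ, Real.norm_eq_abs, Finset.abs_prod]
    rw [restrict_unitCube, integral_fintype_prod_eq_prod (fun i t => |Q v i t|), ← hmu,
      ← Finset.prod_pow_eq_pow_sum, ← Finset.prod_inv_distrib]
    refine Finset.prod_congr rfl fun i _ => ?_
    by_cases hi : i ∈ v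
    · simpa [hQ, hi] using hKint i
    · simp [hQone hi, hi]
  rw [hrep, ← Real.enorm_eq_ofReal_abs]
  refine (enorm_integral_le_lintegral_enorm _).trans ?_
  simp only [enorm_mul]
  have h2 : (2 : ℝ≥0∞) ^ ((v.card : ℝ) / p.toReal) =
      ((2 : ℝ≥0∞) ^ (v.card : ℝ)) ^ (1 / p.toReal) := by
    rw [← ENNReal.rpow_mul, mul_one_div]
  rw [h2]
  have hpos (r : ℝ) : (2 : ℝ≥0∞) ^ r ≠ 0 := by simp [ENNReal.rpow_eq_zero_iff]
  have hfin (r : ℝ) : (2 : ℝ≥0∞) ^ r ≠ ∞ := by simp [ENNReal.rpow_eq_top_iff]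
  exact lintegral_enorm_mul_le (aestronglyMeasurable_projInt v hDint) hκm hp (hpos _) (hpos _)
    (hfin _) hκle hκint


end
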